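/- arXiv:1109.1381 — 6 statements merged into one kernel-verified Lean document; each statement's English description precedes it below -/
import Mathlib

section
/- For all integers p ≥ 0 and q ≥ 0, there exists a unique polynomial B ∈ ℝ[x] such that B(−x) = −B(x) and (2x+1)·(B(x+1) − B(x)) = ((x+1)^p − (−x)^p)·(x+1)^q·(−x)^q. -/
open Polynomial in
/-- The forward difference operator on polynomials over a field of characteristic zero is
surjective. -/
theorem Polynomial.exists_comp_X_add_one_sub_eq {K : Type*} [Field K] [CharZero K] (f : K[X]) :
    ∃ A : K[X], A.comp (X + 1) - A = f := by
  induction f using Polynomial.induction_on' with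
  | add f g hf hg =>
    obtain ⟨A, rfl⟩ := hf
    obtain ⟨B, rfl⟩ := hg
    exact ⟨A + B, by rw [add_comp]; ring⟩
  | monomial n a =>
    have h : (bernoulli (n + 1)).comp (X + 1) - bernoulli (n + 1) = ((n : ℚ[X]) + 1) * X ^ n := by
      rw [add_comm X 1, bernoulli_comp_one_add_X]
      simp
    have hK := congrArg (Polynomial.map (algebraMap ℚ K)) h
    simp only [Polynomial.map_sub, Polynomial.map_comp, Polynomial.map_add, map_X,
      Polynomial.map_one, Polynomial.map_mul, Polynomial.map_pow,
      Polynomial.map_natCast] at hK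
    have hn : (n : K) + 1 ≠ 0 := Nat.cast_add_one_ne_zero n
    refine ⟨C (a / (n + 1)) * (bernoulli (n + 1)).map (algebraMap ℚ K), ?_⟩
    have hC : C (a / (n + 1)) * ((n : K[X]) + 1) = C a := by
      rw [← C_eq_natCast, ← C_1, ← C_add, ← C_mul, div_mul_cancel₀ a hn]
    rw [mul_comp, C_comp, ← mul_sub, hK, ← C_mul_X_pow_eq_monomial, ← hC, mul_assoc]

open Polynomial in
/-- A polynomial with period `1` that vanishes at `0` is zero. -/
theorem Polynomial.eq_zero_of_comp_X_add_one_eq {R : Type*} [CommRing R] [IsDomain R] [CharZero R]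
    {D : R[X]} (hD : D.comp (X + 1) = D) (h0 : D.eval 0 = 0) : D = 0 := by
  have hroot (n : ℕ) : D.IsRoot (n : R) := by
    induction n with
    | zero => simpa using h0
    | succ n ih =>
      rw [← hD, IsRoot, eval_comp] at ih
      simpa using ih
  exact eq_zero_of_infinite_isRoot D
    (Set.infinite_of_injective_forall_mem (f := ((↑) : ℕ → R)) Nat.cast_injective hroot)

/-- For all integers `p ≥ 0` and `q ≥ 0`, there exists a unique polynomial `B ∈ ℝ[x]`
such that `B(−x) = −B(x)` and
`(2x+1)·(B(x+1) − B(x)) = ((x+1)^p − (−x)^p)·(x+1)^q·(−x)^q`. -/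
theorem exists_unique_Bpq (p q : ℕ) :
    ∃! B : Polynomial ℝ,
      B.comp (-Polynomial.X) = -B ∧
      (2 * Polynomial.X + 1) * (B.comp (Polynomial.X + 1) - B)
        = ((Polynomial.X + 1) ^ p - (-Polynomial.X) ^ p)
            * (Polynomial.X + 1) ^ q * (-Polynomial.X) ^ q := by
  open Polynomial in
  have hne : (2 * X + 1 : ℝ[X]) ≠ 0 := fun h ↦ by
    simpa using congrArg (eval 0) h
  obtain ⟨g, hg⟩ : (2 * X + 1 : ℝ[X]) ∣ (X + 1) ^ p - (-X) ^ p := by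
    convert sub_dvd_pow_sub_pow (X + 1 : ℝ[X]) (-X) p using 1
    ring
  obtain ⟨A, hA⟩ := exists_comp_X_add_one_sub_eq (g * (X + 1) ^ q * (-X) ^ q)
  have hgsymm : g.comp (-X - 1) = g := by
    refine mul_left_cancel₀ hne ?_
    have h := congrArg (fun f : ℝ[X] ↦ f.comp (-X - 1)) hg
    simp only [sub_comp, mul_comp, pow_comp, add_comp, neg_comp, X_comp, one_comp,
      ofNat_comp, Nat.cast_ofNat] at h
    have e₁ : (-X - 1 + 1 : ℝ[X]) = -X := by ring
    have e₂ : (-(-X - 1) : ℝ[X]) = X + 1 := by ring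
    rw [e₁, e₂] at h
    linear_combination h + hg
  have hA' : A.comp (-X) - A.comp (-X - 1) = g * (X + 1) ^ q * (-X) ^ q := by
    have h := congrArg (fun f : ℝ[X] ↦ f.comp (-X - 1)) hA
    simp only [sub_comp, mul_comp, pow_comp, add_comp, neg_comp, X_comp, one_comp,
      comp_assoc, hgsymm] at h
    have e₁ : (-X - 1 + 1 : ℝ[X]) = -X := by ring
    have e₂ : (-(-X - 1) : ℝ[X]) = X + 1 := by ring
    rw [e₁, e₂] at h
    linear_combination h
  have hC : (C (1 / 2) * 2 : ℝ[X]) = 1 := by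
    rw [← C_ofNat, ← C_mul]
    norm_num
  refine existsUnique_of_exists_of_unique ?_ ?_
  · refine ⟨C (1 / 2) * (A - A.comp (-X)), ?_, ?_⟩
    · simp only [mul_comp, C_comp, sub_comp, comp_assoc, neg_comp, X_comp, neg_neg, comp_X]
      ring
    · simp only [mul_comp, C_comp, sub_comp, comp_assoc, neg_comp, X_comp]
      have e : (-(X + 1) : ℝ[X]) = -X - 1 := by ring
      rw [e, hg]
      linear_combination (2 * X + 1) * C (1 / 2) * (hA + hA')
        + (2 * X + 1) * (g * (X + 1) ^ q * (-X) ^ q) * hC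
  · rintro B₁ B₂ ⟨hodd₁, hB₁⟩ ⟨hodd₂, hB₂⟩
    refine sub_eq_zero.mp (eq_zero_of_comp_X_add_one_eq ?_ ?_)
    · have h := mul_left_cancel₀ hne (hB₁.trans hB₂.symm)
      rw [sub_comp]
      linear_combination h
    · have h₁ := congrArg (eval 0) hodd₁
      have h₂ := congrArg (eval 0) hodd₂
      simp only [eval_comp, eval_neg, eval_X, neg_zero] at h₁ h₂
      rw [eval_sub]
      linarith
end

section
/- For every integer q ≥ 1, there exists a unique polynomial B ∈ ℝ[x] such that B(−x) = −B(x) and B(x+1) − B(x) = −((−x)(x+1))^{q−1}. -/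
namespace Polynomial

/-- Over a `ℚ`-algebra, the forward difference `A ↦ A(x+1) - A(x)` is surjective on polynomials. -/
theorem exists_comp_X_add_one_sub_eq_s1 {R : Type*} [CommRing R] [Algebra ℚ R] (f : R[X]) :
    ∃ A : R[X], A.comp (X + 1) - A = f := by
  induction f using Polynomial.induction_on' with
  | add p q hp hq =>
    obtain ⟨A, hA⟩ := hp
    obtain ⟨B, hB⟩ := hq
    exact ⟨A + B, by rw [← hA, ← hB, add_comp]; ring⟩
  | monomial n a =>
    refine ⟨C (a * algebraMap ℚ R (n + 1 : ℚ)⁻¹) *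
      (bernoulli (n + 1)).map (algebraMap ℚ R), ?_⟩
    have h := congrArg (map (algebraMap ℚ R)) (bernoulli_comp_one_add_X (n + 1))
    simp only [map_comp, Polynomial.map_add, Polynomial.map_one, map_X,
      Polynomial.map_pow, add_tsub_cancel_right, nsmul_eq_mul, Polynomial.map_mul,
      Polynomial.map_natCast] at h
    have hn : algebraMap ℚ R (n + 1 : ℚ)⁻¹ * ((n + 1 : ℕ) : R) = 1 := by
      rw [← map_natCast (algebraMap ℚ R), ← map_mul, Nat.cast_succ,
        inv_mul_cancel₀ (by positivity), map_one]
    rw [mul_comp, C_comp, add_comm X, h, ← C_mul_X_pow_eq_monomial, ← mul_sub,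
      add_sub_cancel_left, ← mul_assoc, ← C_eq_natCast, ← C_mul, mul_assoc a, hn, mul_one]

/-- A polynomial over a domain of characteristic zero that is invariant under `x ↦ x + 1` is
constant. -/
theorem eq_C_of_comp_X_add_one_eq {R : Type*} [CommRing R] [IsDomain R] [CharZero R] {D : R[X]}
    (h : D.comp (X + 1) = D) : D = C (D.eval 0) := by
  have hD (n : ℕ) : D.eval (n : R) = D.eval 0 := by
    induction n with
    | zero => simp
    | succ n ih =>
      rw [← ih]
      simpa using congrArg (eval (n : R)) h
  refine eq_of_infinite_eval_eq _ _ ((Set.infinite_range_of_injective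
    (Nat.cast_injective (R := R))).mono ?_)
  rintro _ ⟨n, rfl⟩
  simpa using hD n

end Polynomial

/-- For every integer `q ≥ 1`, there exists a unique polynomial `B ∈ ℝ[x]` such that
`B(−x) = −B(x)` and `B(x+1) − B(x) = −((−x)(x+1))^{q−1}`. -/
theorem exists_unique_Bneg1q (q : ℕ) (hq : 1 ≤ q) :
    ∃! B : Polynomial ℝ,
      B.comp (-Polynomial.X) = -B ∧
      B.comp (Polynomial.X + 1) - B
        = -((-Polynomial.X) * (Polynomial.X + 1)) ^ (q - 1) := by
  obtain ⟨A, hA⟩ := Polynomial.exists_comp_X_add_one_sub_eq_s1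
    (-((-Polynomial.X : Polynomial ℝ) * (Polynomial.X + 1)) ^ (q - 1))
  have hA' (x : ℝ) : A.eval (x + 1) - A.eval x = -(-x * (x + 1)) ^ (q - 1) := by
    simpa using congrArg (Polynomial.eval x) hA
  refine existsUnique_of_exists_of_unique
    ⟨Polynomial.C (1 / 2) * (A - A.comp (-Polynomial.X)), ?_, ?_⟩ ?_
  · refine Polynomial.funext fun x => ?_
    simp
    ring
  · refine Polynomial.funext fun x => ?_
    have h₁ := hA' x
    have h₂ := hA' (-x - 1)
    rw [show -(-x - 1) * (-x - 1 + 1) = -x * (x + 1) by ring,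
      show -x - 1 + 1 = -x by ring, show -x - 1 = -(x + 1) by ring] at h₂
    simp only [Polynomial.eval_sub, Polynomial.eval_comp, Polynomial.eval_mul, Polynomial.eval_C,
      Polynomial.eval_neg, Polynomial.eval_X, Polynomial.eval_add, Polynomial.eval_one,
      Polynomial.eval_pow]
    linarith
  · rintro B₁ B₂ ⟨hodd₁, hdiff₁⟩ ⟨hodd₂, hdiff₂⟩
    have hconst := Polynomial.eq_C_of_comp_X_add_one_eq (D := B₁ - B₂) <| by
      rw [Polynomial.sub_comp]
      linear_combination hdiff₁ - hdiff₂
    have h₁ := congrArg (Polynomial.eval 0) hodd₁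
    have h₂ := congrArg (Polynomial.eval 0) hodd₂
    simp only [Polynomial.eval_comp, Polynomial.eval_neg, Polynomial.eval_X, neg_zero] at h₁ h₂
    have hzero : (B₁ - B₂).eval 0 = 0 := by
      rw [Polynomial.eval_sub]
      linarith
    rwa [hzero, Polynomial.C_0, sub_eq_zero] at hconst
end

section
/- Let p ≥ 0 and q ≥ 0 be integers and suppose B ∈ ℝ[x] satisfies (2x+1)·(B(x+1) − B(x)) = ((x+1)^p − (−x)^p)·(x+1)^q·(−x)^q. Then the polynomial B(x) + B(−x) is constant. -/
/-- A real polynomial taking the same value at `n` and `n + 1` for every natural `n` is constant. -/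
theorem Polynomial.eq_C_of_eval_natCast_succ (E : Polynomial ℝ)
    (h : ∀ n : ℕ, E.eval ((n : ℝ) + 1) = E.eval (n : ℝ)) :
    E = Polynomial.C (E.eval 0) := by
  have hn : ∀ n : ℕ, E.eval (n : ℝ) = E.eval 0 := by
    intro n
    induction n with
    | zero => simp
    | succ n ih => rw [Nat.cast_succ, h, ih]
  refine Polynomial.eq_of_infinite_eval_eq _ _
    ((Set.infinite_range_of_injective (Nat.cast_injective (R := ℝ))).mono ?_)
  rintro _ ⟨n, rfl⟩
  simp [hn n]

/-- Let `p ≥ 0` and `q ≥ 0` be integers and suppose `B ∈ ℝ[x]` satisfies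
`(2x+1)·(B(x+1) − B(x)) = ((x+1)^p − (−x)^p)·(x+1)^q·(−x)^q`.
Then the polynomial `B(x) + B(−x)` is constant. -/
theorem B_add_B_neg_isConstant (p q : ℕ) (B : Polynomial ℝ)
    (hB : (2 * Polynomial.X + 1) * (B.comp (Polynomial.X + 1) - B)
        = ((Polynomial.X + 1) ^ p - (-Polynomial.X) ^ p)
            * (Polynomial.X + 1) ^ q * (-Polynomial.X) ^ q) :
    ∃ c : ℝ, B + B.comp (-Polynomial.X) = Polynomial.C c := by
  have heval : ∀ x : ℝ, (2 * x + 1) * (B.eval (x + 1) - B.eval x)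
      = ((x + 1) ^ p - (-x) ^ p) * (x + 1) ^ q * (-x) ^ q := by
    intro x
    simpa using congrArg (Polynomial.eval x) hB
  refine ⟨_, Polynomial.eq_C_of_eval_natCast_succ _ fun n => ?_⟩
  have h₁ := heval n
  have h₂ := heval (-(n + 1))
  rw [show -((n : ℝ) + 1) + 1 = -n by ring, neg_neg] at h₂
  have hn : (2 * (n : ℝ) + 1) ≠ 0 := by positivity
  simp only [Polynomial.eval_add, Polynomial.eval_comp, Polynomial.eval_neg, Polynomial.eval_X]
  apply mul_left_cancel₀ hn
  linear_combination h₁ + h₂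
end

section
/- For every odd integer p ≥ 1, the polynomial B_{p,0} has degree p and leading coefficient 1/p; that is, B_{p,0}(x) − x^p/p has degree strictly less than p. -/
open Polynomial in
/-- If `Q` has degree at most `n + 1`, the coefficient of degree `n` of `Q(x+1) - Q(x)`. -/
theorem Polynomial.coeff_comp_X_add_one_sub_self {R : Type*} [CommRing R] {Q : R[X]} {n : ℕ}
    (hQ : Q.natDegree ≤ n + 1) :
    (Q.comp (X + 1) - Q).coeff n = (n + 1) * Q.coeff (n + 1) := by
  have hcomp : Q.comp (X + 1) = taylor 1 Q := by simp [taylor_apply]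
  have hdeg : (hasseDeriv n Q).natDegree < 2 := by
    have := natDegree_hasseDeriv_le Q n
    omega
  rw [coeff_sub, hcomp, taylor_coeff, eval_eq_sum_range' hdeg]
  simp [Finset.sum_range_succ, hasseDeriv_coeff, Nat.choose_succ_self_right, add_comm 1 n]

open Polynomial in
/-- If `Q` has degree at most `n + 1`, the coefficient of degree `n + 1` of
`(2x+1)(Q(x+1) - Q(x))`. -/
theorem Polynomial.coeff_two_mul_X_add_one_mul_comp_sub {R : Type*} [CommRing R] {Q : R[X]}
    {n : ℕ} (hQ : Q.natDegree ≤ n + 1) :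
    ((2 * X + 1) * (Q.comp (X + 1) - Q)).coeff (n + 1) = 2 * (n + 1) * Q.coeff (n + 1) := by
  have htop : (Q.comp (X + 1) - Q).coeff (n + 1) = 0 := by
    rw [coeff_comp_X_add_one_sub_self (hQ.trans n.succ.le_succ),
      coeff_eq_zero_of_natDegree_lt (by omega), mul_zero]
  rw [add_mul, one_mul, coeff_add, htop, add_zero, mul_assoc, coeff_ofNat_mul, coeff_X_mul,
    coeff_comp_X_add_one_sub_self hQ, mul_assoc]

/-- For every odd integer `p ≥ 1`, the polynomial `B_{p,0}` has degree `p` and leading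
coefficient `1/p`; that is, `B_{p,0}(x) − x^p/p` has degree strictly less than `p`.
Here `B_{p,0}` is the unique polynomial satisfying `B(−x) = −B(x)` and
`(2x+1)·(B(x+1) − B(x)) = ((x+1)^p − (−x)^p)·(x+1)^0·(−x)^0`. -/
theorem Bp0_degree_leadingCoeff (p : ℕ) (hp : Odd p) (hp1 : 1 ≤ p) (B : Polynomial ℝ)
    (hodd : B.comp (-Polynomial.X) = -B)
    (hdiff : (2 * Polynomial.X + 1) * (B.comp (Polynomial.X + 1) - B)
        = ((Polynomial.X + 1) ^ p - (-Polynomial.X) ^ p)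
            * (Polynomial.X + 1) ^ (0 : ℕ) * (-Polynomial.X) ^ (0 : ℕ)) :
    (B - Polynomial.C ((p : ℝ))⁻¹ * Polynomial.X ^ p).degree < (p : WithBot ℕ) := by
  open Polynomial in
  have hrhs (m : ℕ) (hm : p ≤ m) :
      ((2 * X + 1) * (B.comp (X + 1) - B)).coeff m = if m = p then 2 else 0 := by
    rw [hdiff, hp.neg_pow, pow_zero, pow_zero, mul_one, mul_one, sub_neg_eq_add, coeff_add,
      coeff_X_add_one_pow, coeff_X_pow]
    split_ifs with h
    · subst h
      norm_num
    · rw [Nat.choose_eq_zero_of_lt (by omega), Nat.cast_zero, add_zero]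
  have hdeg : B.natDegree ≤ p := by
    by_contra! hlt
    obtain ⟨n, hn⟩ : ∃ n, B.natDegree = n + 1 := ⟨B.natDegree - 1, by omega⟩
    have h := Polynomial.coeff_two_mul_X_add_one_mul_comp_sub hn.le
    rw [hrhs _ (by omega), if_neg (by omega), ← hn, Polynomial.coeff_natDegree] at h
    have hlead : B.leadingCoeff ≠ 0 := by
      rw [Polynomial.leadingCoeff_ne_zero]
      rintro rfl
      simp at hn
    have hpos : (2 * ((n : ℝ) + 1)) ≠ 0 := by positivity
    exact mul_ne_zero hpos hlead h.symm
  rw [Polynomial.degree_lt_iff_coeff_zero]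
  intro m hm
  rw [Polynomial.coeff_sub, Polynomial.coeff_C_mul, Polynomial.coeff_X_pow]
  rcases hm.eq_or_lt with rfl | hlt
  · obtain ⟨n, rfl⟩ : ∃ n, p = n + 1 := ⟨p - 1, by omega⟩
    have h := Polynomial.coeff_two_mul_X_add_one_mul_comp_sub hdeg
    rw [hrhs _ le_rfl, if_pos rfl] at h
    push_cast
    field_simp
    simp
    linarith
  · rw [Polynomial.coeff_eq_zero_of_natDegree_lt (by omega), if_neg hlt.ne', mul_zero, sub_zero]
end

section
/- Let ℓ ≥ 2 and let 1 ≤ i ≤ ℓ, 1 ≤ j ≤ ℓ. If the polynomial φ_j(x_i) is nonzero, then φ_j(x_i) is homogeneous of degree 2(ℓ−1). -/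
open MvPolynomial Finset

noncomputable section

/-- Elementary symmetric function of degree `n` of the values of `f` on the finite set `s`. -/
def esymVal {α R : Type*} [CommSemiring R] (s : Finset α) (f : α → R) (n : ℕ) : R :=
  ∑ t ∈ Finset.powersetCard n s, ∏ a ∈ t, f a

/-- The characterizing conditions for the family of Bernoulli-like polynomials `B p q`
(for `p ≥ -1`, `q ≥ 0`, `(p,q) ≠ (-1,0)`):  oddness and the (denominator-cleared)
difference equations. -/
def BProp (B : ℤ → ℕ → Polynomial ℝ) : Prop :=
  (∀ (p : ℤ) (q : ℕ), -1 ≤ p → ¬(p = -1 ∧ q = 0) →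
      (B p q).comp (-Polynomial.X) = -(B p q)) ∧
  (∀ (p q : ℕ),
      (2 * Polynomial.X + 1) * ((B p q).comp (Polynomial.X + 1) - B p q)
        = ((Polynomial.X + 1) ^ p - (-Polynomial.X) ^ p)
            * (Polynomial.X + 1) ^ q * (-Polynomial.X) ^ q) ∧
  (∀ q : ℕ, 1 ≤ q →
      (B (-1) q).comp (Polynomial.X + 1) - B (-1) q
        = -((-Polynomial.X) * (Polynomial.X + 1)) ^ (q - 1))

/-- The polynomial ring `S = ℝ[x_1, …, x_ℓ, z]`; the variable indexed by
`Fin.castSucc i` is `x_{i+1}` and the variable indexed by `Fin.last ℓ` is `z`. -/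
abbrev SS (ℓ : ℕ) := MvPolynomial (Fin (ℓ + 1)) ℝ

/-- The field of rational functions, in which the defining formulas for the `φ_j` live. -/
abbrev KK (ℓ : ℕ) := FractionRing (SS ℓ)

/-- `x_{i+1}` as a rational function. -/
def xx (ℓ : ℕ) (i : Fin ℓ) : KK ℓ := algebraMap (SS ℓ) (KK ℓ) (X i.castSucc)

/-- `z` as a rational function. -/
def zz (ℓ : ℕ) : KK ℓ := algebraMap (SS ℓ) (KK ℓ) (X (Fin.last ℓ))

/-- `ar B_{p,q}(x, z) = z^{p+2q}·B_{p,q}(x/z)`, as a rational function; by convention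
`ar B_{-1,0}(x,z) = -1/x`. -/
def arB (B : ℤ → ℕ → Polynomial ℝ) (ℓ : ℕ) (p : ℤ) (q : ℕ) (x : KK ℓ) : KK ℓ :=
  if p = -1 ∧ q = 0 then -x⁻¹
  else zz ℓ ^ (p + 2 * (q : ℤ)) *
    Polynomial.eval₂ ((algebraMap (SS ℓ) (KK ℓ)).comp (MvPolynomial.C)) (x / zz ℓ) (B p q)

/-- `J = {x_1, …, x_{j-1}}` (as a set of indices). -/
def Jset (ℓ : ℕ) (j : Fin ℓ) : Finset (Fin ℓ) := univ.filter (· < j)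

/-- The value `φ_j(x_i)` (an element of the fraction field, which is in fact
a polynomial).  Here `j` with `(j:ℕ)+1 < ℓ` encodes `φ_{j+1}`, `1 ≤ j+1 ≤ ℓ-1`,
and `j = Fin.last` encodes `φ_ℓ`. -/
def phi (B : ℤ → ℕ → Polynomial ℝ) (ℓ : ℕ) (j i : Fin ℓ) : KK ℓ :=
  if h : (j : ℕ) + 1 < ℓ then
    (xx ℓ j - xx ℓ ⟨(j : ℕ) + 1, h⟩ - zz ℓ) *
      ∑ K1 ∈ (Jset ℓ j).powerset, ∑ K2 ∈ ((Jset ℓ j) \ K1).powerset,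
        (∏ a ∈ K1, xx ℓ a) * (∏ a ∈ K2, xx ℓ a) ^ 2 * (-zz ℓ) ^ K1.card *
          ∑ n1 ∈ Finset.range 3, ∑ n2 ∈ Finset.range (ℓ - (j : ℕ) - 1),
            (-1 : KK ℓ) ^ (n1 + n2) *
              esymVal ({j, ⟨(j : ℕ) + 1, h⟩} : Finset (Fin ℓ)) (xx ℓ) n1 *
              esymVal (univ.filter (fun a : Fin ℓ => (j : ℕ) + 1 < (a : ℕ)))
                (fun a => xx ℓ a ^ 2) n2 *
              arB B ℓ ((2 - (n1 : ℤ)) + 2 * ((ℓ : ℤ) - (j : ℤ) - 2 - (n2 : ℤ)) - 1)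
                ((j : ℕ) - K1.card - K2.card) (xx ℓ i)
  else
    ∑ K1 ∈ (Jset ℓ j).powerset, ∑ K2 ∈ ((Jset ℓ j) \ K1).powerset,
      (∏ a ∈ K1, xx ℓ a) * (∏ a ∈ K2, xx ℓ a) ^ 2 * (-zz ℓ) ^ K1.card * (-(xx ℓ j)) *
        arB B ℓ (-1) ((j : ℕ) - K1.card - K2.card) (xx ℓ i)


/-- A real polynomial whose forward difference has degree less than `N` has degree at most `N`. -/
theorem natDegree_le_of_degree_comp_sub_lt (f : Polynomial ℝ) (N : ℕ)
    (h : (f.comp (Polynomial.X + 1) - f).degree < N) : f.natDegree ≤ N := by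
  by_contra! hN
  obtain ⟨n, hn⟩ : ∃ n, f.natDegree = n + 1 := ⟨f.natDegree - 1, by omega⟩
  have h1 : (f.comp (Polynomial.X + 1) - f).coeff n = 0 :=
    Polynomial.coeff_eq_zero_of_degree_lt (h.trans_le (by exact_mod_cast (by omega : N ≤ n)))
  have h2 : f.comp (Polynomial.X + 1) = Polynomial.taylor 1 f := by
    rw [Polynomial.taylor_apply, Polynomial.C_1]
  have h3 : (Polynomial.hasseDeriv n f).natDegree < 2 := by
    have := Polynomial.natDegree_hasseDeriv_le f n
    omega
  rw [h2, Polynomial.coeff_sub, Polynomial.taylor_coeff, Polynomial.eval_eq_sum_range' h3] at h1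
  simp only [Finset.sum_range_succ, Finset.sum_range_zero, Polynomial.hasseDeriv_coeff] at h1
  rw [Nat.add_comm 1 n, Nat.choose_succ_self_right] at h1
  simp only [zero_add, Nat.choose_self, Nat.cast_one, one_mul, one_pow, mul_one,
    add_sub_cancel_left] at h1
  have h4 : f.coeff (n + 1) ≠ 0 := by
    rw [← hn, Polynomial.coeff_natDegree, Polynomial.leadingCoeff_ne_zero]
    rintro rfl
    simp at hn
  exact mul_ne_zero (by positivity) h4 h1

theorem BProp.natDegree_le_of_nonneg {B : ℤ → ℕ → Polynomial ℝ} (hB : BProp B) (p q : ℕ) :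
    (B p q).natDegree ≤ p + 2 * q := by
  apply natDegree_le_of_degree_comp_sub_lt
  have h := hB.2.1 p q
  set d := (B p q).comp (Polynomial.X + 1) - B p q
  rcases eq_or_ne d 0 with hd | hd
  · rw [hd, Polynomial.degree_zero]
    exact WithBot.bot_lt_coe _
  have hlin : (2 * Polynomial.X + 1 : Polynomial ℝ).natDegree = 1 := by
    compute_degree!
  have hlin0 : (2 * Polynomial.X + 1 : Polynomial ℝ) ≠ 0 := by
    intro h0
    simp [h0] at hlin
  have hr : (((Polynomial.X + 1) ^ p - (-Polynomial.X) ^ p)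
      * (Polynomial.X + 1) ^ q * (-Polynomial.X) ^ q : Polynomial ℝ).natDegree ≤ p + q + q := by
    have h1 : (Polynomial.X + 1 : Polynomial ℝ).natDegree ≤ 1 := by compute_degree
    have h2 : (-Polynomial.X : Polynomial ℝ).natDegree ≤ 1 := by compute_degree
    have h3 (n : ℕ) := Polynomial.natDegree_pow_le_of_le n h1
    have h4 (n : ℕ) := Polynomial.natDegree_pow_le_of_le n h2
    simp only [mul_one] at h3 h4
    exact Polynomial.natDegree_mul_le_of_le (Polynomial.natDegree_mul_le_of_le
      (Polynomial.natDegree_sub_le_of_le (h3 p) (h4 p) |>.trans (max_self p).le) (h3 q)) (h4 q)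
  rw [← h, Polynomial.natDegree_mul hlin0 hd, hlin] at hr
  rw [Polynomial.degree_eq_natDegree hd]
  exact_mod_cast (by omega : d.natDegree < p + 2 * q)

theorem BProp.natDegree_neg_one_le {B : ℤ → ℕ → Polynomial ℝ} (hB : BProp B) (q : ℕ)
    (hq : 1 ≤ q) : (B (-1) q).natDegree ≤ 2 * q - 1 := by
  apply natDegree_le_of_degree_comp_sub_lt
  rw [hB.2.2 q hq, Polynomial.degree_neg]
  have h1 : (-Polynomial.X * (Polynomial.X + 1) : Polynomial ℝ).natDegree ≤ 2 := by
    compute_degree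
  have h2 := Polynomial.natDegree_pow_le_of_le (q - 1) h1
  refine (Polynomial.degree_le_of_natDegree_le h2).trans_lt ?_
  exact_mod_cast (by omega : (q - 1) * 2 < 2 * q - 1)

/-- The rational function `f` is a homogeneous polynomial of degree `n`. -/
def IsHomogeneousPoly (ℓ n : ℕ) (f : KK ℓ) : Prop :=
  ∃ P : SS ℓ, algebraMap (SS ℓ) (KK ℓ) P = f ∧ P.IsHomogeneous n

namespace IsHomogeneousPoly

variable {ℓ : ℕ}

theorem mul {m n : ℕ} {f g : KK ℓ} (hf : IsHomogeneousPoly ℓ m f)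
    (hg : IsHomogeneousPoly ℓ n g) : IsHomogeneousPoly ℓ (m + n) (f * g) := by
  obtain ⟨P, rfl, hP⟩ := hf
  obtain ⟨Q, rfl, hQ⟩ := hg
  exact ⟨P * Q, map_mul _ _ _, hP.mul hQ⟩

theorem sub {n : ℕ} {f g : KK ℓ} (hf : IsHomogeneousPoly ℓ n f)
    (hg : IsHomogeneousPoly ℓ n g) : IsHomogeneousPoly ℓ n (f - g) := by
  obtain ⟨P, rfl, hP⟩ := hf
  obtain ⟨Q, rfl, hQ⟩ := hg
  exact ⟨P - Q, map_sub _ _ _, hP.sub hQ⟩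

theorem neg {n : ℕ} {f : KK ℓ} (hf : IsHomogeneousPoly ℓ n f) :
    IsHomogeneousPoly ℓ n (-f) := by
  obtain ⟨P, rfl, hP⟩ := hf
  exact ⟨-P, map_neg _ _, hP.neg⟩

theorem sum {ι : Type*} {s : Finset ι} {n : ℕ} {f : ι → KK ℓ}
    (h : ∀ a ∈ s, IsHomogeneousPoly ℓ n (f a)) : IsHomogeneousPoly ℓ n (∑ a ∈ s, f a) := by
  choose! P hP hP' using h
  refine ⟨∑ a ∈ s, P a, ?_, IsHomogeneous.sum _ _ _ hP'⟩
  rw [map_sum]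
  exact Finset.sum_congr rfl hP

theorem pow {n : ℕ} {f : KK ℓ} (hf : IsHomogeneousPoly ℓ n f) (k : ℕ) :
    IsHomogeneousPoly ℓ (n * k) (f ^ k) := by
  obtain ⟨P, rfl, hP⟩ := hf
  exact ⟨P ^ k, map_pow _ _ _, hP.pow k⟩

theorem prod {ι : Type*} {s : Finset ι} {n : ℕ} {f : ι → KK ℓ}
    (h : ∀ a ∈ s, IsHomogeneousPoly ℓ n (f a)) :
    IsHomogeneousPoly ℓ (n * s.card) (∏ a ∈ s, f a) := by
  choose! P hP hP' using h
  refine ⟨∏ a ∈ s, P a, ?_, ?_⟩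
  · rw [map_prod]
    exact Finset.prod_congr rfl hP
  · have := IsHomogeneous.prod s P (fun _ => n) hP'
    rwa [Finset.sum_const, smul_eq_mul, mul_comm] at this

theorem const (c : ℝ) : IsHomogeneousPoly ℓ 0 (algebraMap (SS ℓ) (KK ℓ) (MvPolynomial.C c)) :=
  ⟨_, rfl, isHomogeneous_C _ _⟩

theorem one : IsHomogeneousPoly ℓ 0 1 := ⟨1, map_one _, isHomogeneous_one _ _⟩

theorem neg_one_pow (k : ℕ) : IsHomogeneousPoly ℓ 0 ((-1) ^ k) := by
  simpa using (one (ℓ := ℓ)).neg.pow k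

theorem xx (i : Fin ℓ) : IsHomogeneousPoly ℓ 1 (xx ℓ i) := ⟨_, rfl, isHomogeneous_X _ _⟩

theorem zz : IsHomogeneousPoly ℓ 1 (zz ℓ) := ⟨_, rfl, isHomogeneous_X _ _⟩

theorem prod_xx (s : Finset (Fin ℓ)) :
    IsHomogeneousPoly ℓ s.card (∏ a ∈ s, _root_.xx ℓ a) := by
  simpa using prod (s := s) fun a _ => xx a

theorem esymVal {ι : Type*} (s : Finset ι) {m : ℕ} (f : ι → KK ℓ) (n : ℕ)
    (h : ∀ a, IsHomogeneousPoly ℓ m (f a)) : IsHomogeneousPoly ℓ (m * n) (esymVal s f n) := by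
  refine sum fun t ht => ?_
  have := prod (s := t) fun a _ => h a
  rwa [(Finset.mem_powersetCard.1 ht).2] at this

end IsHomogeneousPoly

theorem xx_ne_zero (ℓ : ℕ) (i : Fin ℓ) : xx ℓ i ≠ 0 := by
  simp [xx, X_ne_zero]

theorem zz_ne_zero (ℓ : ℕ) : zz ℓ ≠ 0 := by
  simp [zz, X_ne_zero]

theorem isHomogeneousPoly_zpow_mul_eval₂ (ℓ N : ℕ) (i : Fin ℓ) (f : Polynomial ℝ)
    (hf : f.natDegree ≤ N) :
    IsHomogeneousPoly ℓ N (zz ℓ ^ (N : ℤ) *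
      Polynomial.eval₂ ((algebraMap (SS ℓ) (KK ℓ)).comp MvPolynomial.C) (xx ℓ i / zz ℓ) f) := by
  rw [Polynomial.eval₂_eq_sum_range' _ (Nat.lt_succ_of_le hf), Finset.mul_sum]
  refine .sum fun m hm => ?_
  have hm : m ≤ N := Nat.lt_succ_iff.1 (Finset.mem_range.1 hm)
  have hz := zz_ne_zero ℓ
  have e : zz ℓ ^ (N : ℤ) * (((algebraMap (SS ℓ) (KK ℓ)).comp MvPolynomial.C) (f.coeff m) *
      (xx ℓ i / zz ℓ) ^ m) =
      algebraMap (SS ℓ) (KK ℓ) (MvPolynomial.C (f.coeff m)) * xx ℓ i ^ m * zz ℓ ^ (N - m) := by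
    obtain ⟨k, rfl⟩ := Nat.exists_eq_add_of_le hm
    rw [RingHom.comp_apply, Nat.add_sub_cancel_left, zpow_natCast, pow_add, div_pow]
    field_simp
  rw [e]
  convert ((IsHomogeneousPoly.const (f.coeff m)).mul ((IsHomogeneousPoly.xx i).pow m)).mul
    (IsHomogeneousPoly.zz.pow (N - m)) using 1
  omega

theorem BProp.isHomogeneousPoly_arB {B : ℤ → ℕ → Polynomial ℝ} (hB : BProp B) (ℓ N : ℕ)
    (i : Fin ℓ) (p : ℤ) (q : ℕ) (hp : -1 ≤ p) (hpq : ¬(p = -1 ∧ q = 0))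
    (hN : (N : ℤ) = p + 2 * q) : IsHomogeneousPoly ℓ N (arB B ℓ p q (xx ℓ i)) := by
  rw [arB, if_neg hpq, ← hN]
  apply isHomogeneousPoly_zpow_mul_eval₂
  rcases eq_or_lt_of_le hp with rfl | hp
  · exact (hB.natDegree_neg_one_le q (by omega)).trans (by omega)
  · lift p to ℕ using by omega
    exact (hB.natDegree_le_of_nonneg p q).trans (by omega)

/-- The rational function `f` is `x_i` times a homogeneous polynomial of degree `n`. -/
def IsHomogeneousMultiple (ℓ : ℕ) (i : Fin ℓ) (n : ℕ) (f : KK ℓ) : Prop :=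
  ∃ g, IsHomogeneousPoly ℓ n g ∧ f = xx ℓ i * g

namespace IsHomogeneousMultiple

variable {ℓ : ℕ} {i : Fin ℓ}

theorem mul_right {m n : ℕ} {f g : KK ℓ} (hf : IsHomogeneousMultiple ℓ i m f)
    (hg : IsHomogeneousPoly ℓ n g) : IsHomogeneousMultiple ℓ i (m + n) (f * g) := by
  obtain ⟨f, hf, rfl⟩ := hf
  exact ⟨f * g, hf.mul hg, mul_assoc _ _ _⟩

theorem mul_left {m n : ℕ} {f g : KK ℓ} (hf : IsHomogeneousPoly ℓ m f)
    (hg : IsHomogeneousMultiple ℓ i n g) : IsHomogeneousMultiple ℓ i (m + n) (f * g) := by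
  obtain ⟨g, hg, rfl⟩ := hg
  exact ⟨f * g, hf.mul hg, mul_left_comm _ _ _⟩

theorem prod_xx {s : Finset (Fin ℓ)} (hi : i ∈ s) :
    IsHomogeneousMultiple ℓ i (s.card - 1) (∏ a ∈ s, xx ℓ a) := by
  refine ⟨_, ?_, (Finset.mul_prod_erase s (xx ℓ) hi).symm⟩
  rw [← Finset.card_erase_of_mem hi]
  exact .prod_xx _

theorem prod_xx_sq {s : Finset (Fin ℓ)} (hi : i ∈ s) :
    IsHomogeneousMultiple ℓ i (2 * s.card - 1) ((∏ a ∈ s, xx ℓ a) ^ 2) := by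
  have hs := Finset.card_pos.2 ⟨i, hi⟩
  convert (prod_xx hi).mul_right (.prod_xx s) using 1
  · omega
  · exact sq _

theorem mul_inv {n : ℕ} {f : KK ℓ} (hf : IsHomogeneousMultiple ℓ i n f) :
    IsHomogeneousPoly ℓ n (f * -(xx ℓ i)⁻¹) := by
  obtain ⟨g, hg, rfl⟩ := hf
  convert hg.neg using 1
  have := xx_ne_zero ℓ i
  field_simp

end IsHomogeneousMultiple

theorem esymVal_card {α R : Type*} [CommSemiring R] (s : Finset α) (f : α → R) :
    esymVal s f s.card = ∏ a ∈ s, f a := by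
  rw [esymVal, Finset.powersetCard_self, Finset.sum_singleton]

/-- The monomial attached to a pair `(K1, K2)` in the definition of `phi`. -/
theorem isHomogeneousPoly_weight {ℓ : ℕ} (K1 K2 : Finset (Fin ℓ)) :
    IsHomogeneousPoly ℓ (2 * (K1.card + K2.card))
      ((∏ a ∈ K1, xx ℓ a) * (∏ a ∈ K2, xx ℓ a) ^ 2 * (-zz ℓ) ^ K1.card) := by
  convert ((IsHomogeneousPoly.prod_xx K1).mul ((IsHomogeneousPoly.prod_xx K2).pow 2)).mul
    (IsHomogeneousPoly.zz.neg.pow K1.card) using 1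
  ring

theorem isHomogeneousMultiple_weight {ℓ : ℕ} {i : Fin ℓ} {K1 K2 : Finset (Fin ℓ)}
    (hi : i ∈ K1 ∪ K2) :
    IsHomogeneousMultiple ℓ i (2 * (K1.card + K2.card) - 1)
      ((∏ a ∈ K1, xx ℓ a) * (∏ a ∈ K2, xx ℓ a) ^ 2 * (-zz ℓ) ^ K1.card) := by
  rcases Finset.mem_union.1 hi with h | h
  · have := Finset.card_pos.2 ⟨i, h⟩
    convert ((IsHomogeneousMultiple.prod_xx h).mul_right ((IsHomogeneousPoly.prod_xx K2).pow 2)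
      ).mul_right (IsHomogeneousPoly.zz.neg.pow K1.card) using 1
    omega
  · have := Finset.card_pos.2 ⟨i, h⟩
    convert (IsHomogeneousMultiple.mul_left (.prod_xx K1)
      (IsHomogeneousMultiple.prod_xx_sq h)).mul_right
      (IsHomogeneousPoly.zz.neg.pow K1.card) using 1
    omega

theorem card_Jset (ℓ : ℕ) (j : Fin ℓ) : (Jset ℓ j).card = j := by
  rw [Jset, Finset.filter_gt_eq_Iio, Fin.card_Iio]

theorem card_add_card_le {ℓ : ℕ} {j : Fin ℓ} {K1 K2 : Finset (Fin ℓ)}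
    (h1 : K1 ∈ (Jset ℓ j).powerset) (h2 : K2 ∈ (Jset ℓ j \ K1).powerset) :
    K1.card + K2.card ≤ j := by
  rw [Finset.mem_powerset] at h1 h2
  have h := Finset.card_le_card h2
  have h' := Finset.card_le_card h1
  rw [Finset.card_sdiff_of_subset h1, card_Jset] at h
  rw [card_Jset] at h'
  omega

theorem mem_union_of_card_add_card {ℓ : ℕ} {i j : Fin ℓ} {K1 K2 : Finset (Fin ℓ)}
    (h1 : K1 ∈ (Jset ℓ j).powerset) (h2 : K2 ∈ (Jset ℓ j \ K1).powerset)
    (h : K1.card + K2.card = j) (hij : i < j) : i ∈ K1 ∪ K2 := by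
  rw [Finset.mem_powerset] at h1 h2
  have hd : Disjoint K1 K2 :=
    (Finset.disjoint_of_subset_left h2 Finset.sdiff_disjoint).symm
  have e : K1 ∪ K2 = Jset ℓ j := by
    apply Finset.eq_of_subset_of_card_le
    · exact Finset.union_subset h1 (h2.trans Finset.sdiff_subset)
    · rw [Finset.card_union_of_disjoint hd, card_Jset, h]
  rw [e]
  simpa [Jset] using hij

theorem card_filter_succ_lt {ℓ : ℕ} (j : Fin ℓ) (h : (j : ℕ) + 1 < ℓ) :
    (univ.filter (fun a : Fin ℓ => (j : ℕ) + 1 < (a : ℕ))).card = ℓ - j - 2 := by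
  have e : univ.filter (fun a : Fin ℓ => (j : ℕ) + 1 < (a : ℕ)) =
      Finset.Ioi (⟨(j : ℕ) + 1, h⟩ : Fin ℓ) := by
    ext a
    simp [Fin.lt_def]
  rw [e, Fin.card_Ioi]
  simp only
  omega

/-- Let `ℓ ≥ 2` and let `1 ≤ i ≤ ℓ`, `1 ≤ j ≤ ℓ`.  If the polynomial `φ_j(x_i)` is
nonzero, then `φ_j(x_i)` is homogeneous of degree `2(ℓ−1)`.  (Formally: the rational
function `φ_j(x_i)` is the image of a homogeneous polynomial of degree `2(ℓ−1)`.) -/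
theorem phi_isHomogeneous (B : ℤ → ℕ → Polynomial ℝ) (hB : BProp B)
    (ℓ : ℕ) (hℓ : 2 ≤ ℓ) (i j : Fin ℓ) (h0 : phi B ℓ j i ≠ 0) :
    ∃ P : SS ℓ, algebraMap (SS ℓ) (KK ℓ) P = phi B ℓ j i ∧
      P.IsHomogeneous (2 * (ℓ - 1)) := by
  change IsHomogeneousPoly ℓ (2 * (ℓ - 1)) (phi B ℓ j i)
  clear h0
  unfold phi
  split_ifs with h
  · have hlin : IsHomogeneousPoly ℓ 1 (xx ℓ j - xx ℓ ⟨(j : ℕ) + 1, h⟩ - zz ℓ) :=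
      ((IsHomogeneousPoly.xx _).sub (.xx _)).sub .zz
    have e : 2 * (ℓ - 1) = 1 + (2 * ℓ - 3) := by omega
    rw [e]
    refine hlin.mul (.sum fun K1 h1 => .sum fun K2 h2 => ?_)
    have hc := card_add_card_le h1 h2
    simp only [Finset.mul_sum]
    refine .sum fun n1 hn1 => .sum fun n2 hn2 => ?_
    rw [Finset.mem_range] at hn1 hn2
    rw [← mul_assoc]
    have hw := isHomogeneousPoly_weight K1 K2
    have hσ1 := IsHomogeneousPoly.esymVal ({j, ⟨(j : ℕ) + 1, h⟩} : Finset (Fin ℓ)) (xx ℓ) n1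
      IsHomogeneousPoly.xx
    have hσ2 := IsHomogeneousPoly.esymVal (univ.filter (fun a : Fin ℓ => (j : ℕ) + 1 < (a : ℕ)))
      (fun a => xx ℓ a ^ 2) n2 (fun a => (IsHomogeneousPoly.xx a).pow 2)
    have hs := IsHomogeneousPoly.neg_one_pow (ℓ := ℓ) (n1 + n2)
    by_cases hk : (2 - (n1 : ℤ)) + 2 * ((ℓ : ℤ) - (j : ℤ) - 2 - (n2 : ℤ)) - 1 = -1 ∧
        (j : ℕ) - K1.card - K2.card = 0
    · rw [arB, if_pos hk]
      apply IsHomogeneousMultiple.mul_inv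
      obtain rfl : n1 = 2 := by omega
      obtain rfl : n2 = ℓ - j - 2 := by omega
      rcases lt_or_ge i j with hij | hij
      · have hi := mem_union_of_card_add_card h1 h2 (by omega) hij
        have := Finset.card_pos.2 ⟨i, hi⟩
        have := Finset.card_union_le K1 K2
        convert (isHomogeneousMultiple_weight hi).mul_right ((hs.mul hσ1).mul hσ2) using 1
        omega
      by_cases hij' : (j : ℕ) + 1 < i
      · have hi : i ∈ univ.filter (fun a : Fin ℓ => (j : ℕ) + 1 < (a : ℕ)) := by simpa using hij'
        have hm := IsHomogeneousMultiple.prod_xx_sq hi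
        rw [← Finset.prod_pow, ← esymVal_card, card_filter_succ_lt j h] at hm
        convert IsHomogeneousMultiple.mul_left hw (.mul_left (hs.mul hσ1) hm) using 1
        omega
      · have hi : i ∈ ({j, ⟨(j : ℕ) + 1, h⟩} : Finset (Fin ℓ)) := by
          rw [Finset.mem_insert, Finset.mem_singleton, Fin.ext_iff, Fin.ext_iff]
          rw [Fin.le_def] at hij
          simp only
          omega
        have hcard : ({j, ⟨(j : ℕ) + 1, h⟩} : Finset (Fin ℓ)).card = 2 :=
          Finset.card_pair (by simp [Fin.ext_iff])
        have hm := IsHomogeneousMultiple.prod_xx hi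
        rw [← esymVal_card, hcard] at hm
        convert IsHomogeneousMultiple.mul_left hw
          (IsHomogeneousMultiple.mul_right (.mul_left hs hm) hσ2) using 1
        omega
    · have hb := hB.isHomogeneousPoly_arB ℓ
        ((1 + 2 * (ℓ - j - 2 - n2) + 2 * (j - K1.card - K2.card)) - n1) i _ _ (by omega) hk
        (by omega)
      convert (hw.mul ((hs.mul hσ1).mul hσ2)).mul hb using 1
      omega
  · refine .sum fun K1 h1 => .sum fun K2 h2 => ?_
    have hc := card_add_card_le h1 h2
    have hj : (j : ℕ) = ℓ - 1 := by omega
    have hw := isHomogeneousPoly_weight K1 K2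
    by_cases hk : (j : ℕ) - K1.card - K2.card = 0
    · rw [arB, if_pos ⟨rfl, hk⟩]
      apply IsHomogeneousMultiple.mul_inv
      rcases lt_or_ge i j with hij | hij
      · have hi := mem_union_of_card_add_card h1 h2 (by omega) hij
        convert (isHomogeneousMultiple_weight hi).mul_right (IsHomogeneousPoly.xx j).neg using 1
        omega
      · obtain rfl : i = j := by
          rw [Fin.le_def] at hij
          omega
        have hm : IsHomogeneousMultiple ℓ i 0 (-xx ℓ i) := ⟨-1, IsHomogeneousPoly.one.neg, by ring⟩
        convert IsHomogeneousMultiple.mul_left hw hm using 1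
        omega
    · have hb := hB.isHomogeneousPoly_arB ℓ (2 * (j - K1.card - K2.card) - 1) i (-1) _ le_rfl
        (fun h => hk h.2) (by omega)
      convert (hw.mul (IsHomogeneousPoly.xx j).neg).mul hb using 1
      omega

end
end

section
/- Let ℓ ≥ 2 and let 1 ≤ i < j ≤ ℓ. If φ_j(x_i) is nonzero, then in(φ_j(x_i)) < x_1²·x_2²⋯x_{i−1}²·x_i^{2ℓ−2i} in the pure lexicographic order (strict inequality). -/
open MvPolynomial Finset

noncomputable section

/-- The exponent vector of the monomial `x_1²·x_2²⋯x_{i−1}²·x_i^{2ℓ−2i}`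
(with the `1`-based index `i` corresponding to `i : Fin ℓ` via `i ↦ (i:ℕ)+1`). -/
def expo (ℓ : ℕ) (i : Fin ℓ) : Fin (ℓ + 1) →₀ ℕ :=
  Finsupp.equivFunOnFinite.symm fun p =>
    if (p : ℕ) < (i : ℕ) then 2
    else if (p : ℕ) = (i : ℕ) then 2 * (ℓ - 1 - (i : ℕ)) else 0

theorem Polynomial.coeff_comp_X_add_one_sub_ne_zero {R : Type*} [CommRing R] [CharZero R]
    [NoZeroDivisors R] {f : Polynomial R} {k : ℕ} (hk : f.natDegree = k + 1) :
    (f.comp (Polynomial.X + 1) - f).coeff k ≠ 0 := by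
  have hdeg : (Polynomial.hasseDeriv k f).natDegree < 2 := by
    have := Polynomial.natDegree_hasseDeriv_le f k
    omega
  have htaylor : f.comp (Polynomial.X + 1) = Polynomial.taylor 1 f := by
    simp [Polynomial.taylor_apply]
  have hcoeff : (f.comp (Polynomial.X + 1) - f).coeff k = (k + 1) * f.coeff (k + 1) := by
    rw [Polynomial.coeff_sub, htaylor, Polynomial.taylor_coeff,
      Polynomial.eval_eq_sum_range' hdeg]
    simp [Finset.sum_range_succ, Polynomial.hasseDeriv_coeff, add_comm 1 k]
  rw [hcoeff, ← hk]
  exact mul_ne_zero (by exact_mod_cast k.succ_ne_zero)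
    (Polynomial.leadingCoeff_ne_zero.2 (by rintro rfl; simp at hk))

theorem BProp.natDegree_le {B : ℤ → ℕ → Polynomial ℝ} (hB : BProp B) {p : ℤ} {q : ℕ}
    (hp : -1 ≤ p) (hpq : ¬(p = -1 ∧ q = 0)) : (B p q).natDegree ≤ (p + 2 * (q : ℤ)).toNat := by
  rcases hn : (B p q).natDegree with _ | k
  · exact Nat.zero_le _
  have hne := Polynomial.coeff_comp_X_add_one_sub_ne_zero hn
  have hk := Polynomial.le_natDegree_of_ne_zero hne
  rcases hp.eq_or_lt with rfl | hp
  · have hq : 1 ≤ q := by grind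
    rw [hB.2.2 q hq] at hk
    have : (-((-Polynomial.X) * (Polynomial.X + 1)) ^ (q - 1) : Polynomial ℝ).natDegree
        ≤ (q - 1) * 2 := by compute_degree
    omega
  · lift p to ℕ using by omega
    have hle : ((2 * Polynomial.X + 1) * ((B p q).comp (Polynomial.X + 1) - B p q)).natDegree
        ≤ p + q + q := by
      rw [hB.2.1 p q]
      have h₁ : ((Polynomial.X + 1) ^ p - (-Polynomial.X) ^ p : Polynomial ℝ).natDegree ≤ p := by
        compute_degree
      have h₂ : ((Polynomial.X + 1) ^ q : Polynomial ℝ).natDegree ≤ q := by compute_degree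
      have h₃ : ((-Polynomial.X) ^ q : Polynomial ℝ).natDegree ≤ q := by compute_degree
      exact Polynomial.natDegree_mul_le_of_le (Polynomial.natDegree_mul_le_of_le h₁ h₂) h₃
    have hlin : (2 * Polynomial.X + 1 : Polynomial ℝ).natDegree = 1 := by
      compute_degree!
    rw [Polynomial.natDegree_mul (by rintro h; simp [h] at hlin)
      (by rintro h; simp [h] at hne), hlin] at hle
    omega

/-- The total degree of `Q` is at most `n`, and the degree of `Q` in each variable before `s` is at
most `m`. -/
def BoundedBy {σ : Type*} [LT σ] (s : σ) (n m : ℕ) (Q : MvPolynomial σ ℝ) : Prop :=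
  Q.totalDegree ≤ n ∧ ∀ a < s, Q.degreeOf a ≤ m

namespace BoundedBy

variable {σ : Type*} [LinearOrder σ] {s : σ} {n n' m m' : ℕ} {P Q : MvPolynomial σ ℝ}

theorem mono (h : BoundedBy s n m Q) (hn : n ≤ n') (hm : m ≤ m') : BoundedBy s n' m' Q :=
  ⟨h.1.trans hn, fun a ha => (h.2 a ha).trans hm⟩

theorem mul (hP : BoundedBy s n m P) (hQ : BoundedBy s n' m' Q) :
    BoundedBy s (n + n') (m + m') (P * Q) :=
  ⟨(totalDegree_mul _ _).trans (add_le_add hP.1 hQ.1),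
    fun a ha => (degreeOf_mul_le _ _ _).trans (add_le_add (hP.2 a ha) (hQ.2 a ha))⟩

theorem neg (h : BoundedBy s n m Q) : BoundedBy s n m (-Q) :=
  ⟨by simpa using h.1, fun a ha => by simpa using h.2 a ha⟩

theorem pow (h : BoundedBy s n m Q) (k : ℕ) : BoundedBy s (k * n) (k * m) (Q ^ k) :=
  ⟨(totalDegree_pow _ _).trans (Nat.mul_le_mul_left k h.1),
    fun a ha => (degreeOf_pow_le _ _ _).trans (Nat.mul_le_mul_left k (h.2 a ha))⟩

theorem const (c : ℝ) : BoundedBy s 0 0 (C c) :=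
  ⟨by simp, fun a _ => by simp [degreeOf_C]⟩

theorem X_of_le {b : σ} (hb : s ≤ b) : BoundedBy s 1 0 (X b) :=
  ⟨by simp, fun _ ha => (degreeOf_X_of_ne (ha.trans_le hb).ne).le⟩

theorem sum {ι : Type*} {t : Finset ι} {f : ι → MvPolynomial σ ℝ}
    (h : ∀ k ∈ t, BoundedBy s n m (f k)) : BoundedBy s n m (∑ k ∈ t, f k) :=
  ⟨totalDegree_finsetSum_le fun k hk => (h k hk).1,
    fun a ha => (degreeOf_sum_le _ _ _).trans (Finset.sup_le fun k hk => (h k hk).2 a ha)⟩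

theorem prod {ι : Type*} {t : Finset ι} {f : ι → MvPolynomial σ ℝ}
    (h : ∀ k ∈ t, BoundedBy s n m (f k)) : BoundedBy s (t.card * n) (t.card * m) (∏ k ∈ t, f k) := by
  refine ⟨(totalDegree_finsetProd _ _).trans ?_, fun a ha => (degreeOf_prod_le _ _ _).trans ?_⟩
  · simpa using Finset.sum_le_card_nsmul _ _ _ fun k hk => (h k hk).1
  · simpa using Finset.sum_le_card_nsmul _ _ _ fun k hk => (h k hk).2 a ha

theorem of_mul_X (h : BoundedBy s (n + 1) m (Q * X s)) : BoundedBy s n m Q := by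
  rcases eq_or_ne Q 0 with rfl | hQ
  · exact ⟨by simp, by simp⟩
  refine ⟨?_, fun a ha => ?_⟩
  · have := h.1
    rw [totalDegree_mul_of_isDomain hQ (X_ne_zero s), totalDegree_X] at this
    omega
  · simpa [degreeOf_mul_X_of_ne _ ha.ne] using h.2 a ha

theorem esymVal {ι : Type*} {t : Finset ι} {f : ι → MvPolynomial σ ℝ} {k : ℕ}
    (h : ∀ a ∈ t, BoundedBy s n 0 (f a)) : BoundedBy s (k * n) 0 (esymVal t f k) := by
  refine sum fun u hu => ?_
  rw [mem_powersetCard] at hu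
  simpa [hu.2] using prod fun a ha => h a (hu.1 ha)

end BoundedBy

theorem map_esymVal {α R S : Type*} [CommSemiring R] [CommSemiring S] (φ : R →+* S)
    (s : Finset α) (f : α → R) (n : ℕ) :
    φ (esymVal s f n) = esymVal s (fun a => φ (f a)) n := by
  simp [esymVal, map_sum, map_prod]

/-- The numerator `∏K₁ · (∏K₂)² · (-z)^|K₁|` as a polynomial. -/
def pairMonomial (ℓ : ℕ) (K1 K2 : Finset (Fin ℓ)) : SS ℓ :=
  (∏ a ∈ K1, X a.castSucc) * (∏ a ∈ K2, X a.castSucc) ^ 2 * (-X (Fin.last ℓ)) ^ K1.card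

theorem algebraMap_pairMonomial (ℓ : ℕ) (K1 K2 : Finset (Fin ℓ)) :
    algebraMap (SS ℓ) (KK ℓ) (pairMonomial ℓ K1 K2) =
      (∏ a ∈ K1, xx ℓ a) * (∏ a ∈ K2, xx ℓ a) ^ 2 * (-zz ℓ) ^ K1.card := by
  simp [pairMonomial, xx, zz, map_prod]

theorem totalDegree_prod_X_castSucc_le (ℓ : ℕ) (K : Finset (Fin ℓ)) :
    (∏ a ∈ K, X a.castSucc : SS ℓ).totalDegree ≤ K.card :=
  (totalDegree_finsetProd _ _).trans (by simp)

theorem degreeOf_prod_X_castSucc_le (ℓ : ℕ) (K : Finset (Fin ℓ)) (b : Fin ℓ) :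
    (∏ a ∈ K, X a.castSucc : SS ℓ).degreeOf b.castSucc ≤ if b ∈ K then 1 else 0 :=
  (degreeOf_prod_le _ _ _).trans (by simp [degreeOf_X])

theorem boundedBy_pairMonomial {ℓ : ℕ} (i : Fin ℓ) {K1 K2 : Finset (Fin ℓ)}
    (hK : Disjoint K1 K2) :
    BoundedBy i.castSucc (2 * (K1.card + K2.card)) 2 (pairMonomial ℓ K1 K2) := by
  have hz : BoundedBy i.castSucc (K1.card * 1) (K1.card * 0)
      ((-X (Fin.last ℓ) : SS ℓ) ^ K1.card) :=
    (BoundedBy.X_of_le (Fin.le_last _)).neg.pow _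
  constructor
  · have h₁ := totalDegree_prod_X_castSucc_le ℓ K1
    have h₂ := (totalDegree_pow (∏ a ∈ K2, X a.castSucc : SS ℓ) 2).trans
      (Nat.mul_le_mul_left 2 (totalDegree_prod_X_castSucc_le ℓ K2))
    have := (totalDegree_mul _ _).trans
      (add_le_add ((totalDegree_mul _ _).trans (add_le_add h₁ h₂)) hz.1)
    unfold pairMonomial
    omega
  · intro a ha
    obtain ⟨b, rfl⟩ : ∃ b : Fin ℓ, b.castSucc = a :=
      Fin.exists_castSucc_eq.2 (ha.trans (Fin.castSucc_lt_last i)).ne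
    have h₁ := degreeOf_prod_X_castSucc_le ℓ K1 b
    have h₂ := (degreeOf_pow_le b.castSucc (∏ a ∈ K2, X a.castSucc : SS ℓ) 2).trans
      (Nat.mul_le_mul_left 2 (degreeOf_prod_X_castSucc_le ℓ K2 b))
    have := (degreeOf_mul_le _ _ _).trans
      (add_le_add ((degreeOf_mul_le _ _ _).trans (add_le_add h₁ h₂)) (hz.2 _ ha))
    refine this.trans ?_
    have hb : b ∈ K1 → b ∉ K2 := fun h => Finset.disjoint_left.1 hK h
    split_ifs <;> simp_all

theorem X_dvd_pairMonomial {ℓ : ℕ} {i : Fin ℓ} {K1 K2 : Finset (Fin ℓ)} (hi : i ∈ K1 ∪ K2) :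
    X i.castSucc ∣ pairMonomial ℓ K1 K2 := by
  unfold pairMonomial
  rcases Finset.mem_union.1 hi with h | h
  · exact ((Finset.dvd_prod_of_mem (fun a : Fin ℓ => (X a.castSucc : SS ℓ)) h).mul_right _).mul_right _
  · exact (((Finset.dvd_prod_of_mem (fun a : Fin ℓ => (X a.castSucc : SS ℓ)) h).trans
      (dvd_pow_self _ two_ne_zero)).mul_left _).mul_right _

theorem exists_boundedBy_arB {B : ℤ → ℕ → Polynomial ℝ} (hB : BProp B) {ℓ : ℕ} (i : Fin ℓ)
    {p : ℤ} {q : ℕ} (hp : -1 ≤ p) (hpq : ¬(p = -1 ∧ q = 0)) :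
    ∃ Q : SS ℓ, algebraMap (SS ℓ) (KK ℓ) Q = arB B ℓ p q (xx ℓ i) ∧
      BoundedBy i.castSucc (p + 2 * (q : ℤ)).toNat 0 Q := by
  set N := (p + 2 * (q : ℤ)).toNat with hN
  refine ⟨∑ m ∈ range (N + 1),
    C ((B p q).coeff m) * X i.castSucc ^ m * X (Fin.last ℓ) ^ (N - m), ?_, ?_⟩
  · have hz : zz ℓ ≠ 0 := by simp [zz]
    have hpN : p + 2 * (q : ℤ) = (N : ℕ) := by grind
    rw [arB, if_neg hpq, hpN, zpow_natCast,
      Polynomial.eval₂_eq_sum_range' _ (Nat.lt_succ_of_le (hB.natDegree_le hp hpq)), mul_sum,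
      map_sum]
    refine Finset.sum_congr rfl fun m hm => ?_
    have hm : m ≤ N := Nat.lt_succ_iff.1 (mem_range.1 hm)
    rw [← Nat.sub_add_cancel hm, pow_add, Nat.add_sub_cancel]
    simp only [map_mul, map_pow, RingHom.comp_apply]
    change _ * xx ℓ i ^ m * zz ℓ ^ (N - m) = _
    rw [div_pow]
    field_simp
  · refine BoundedBy.sum fun m hm => ?_
    have hm : m ≤ N := Nat.lt_succ_iff.1 (mem_range.1 hm)
    exact (((BoundedBy.const _).mul ((BoundedBy.X_of_le le_rfl).pow m)).mul
      ((BoundedBy.X_of_le (Fin.le_last _)).pow (N - m))).mono (by omega) (by omega)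

theorem exists_boundedBy_mul_arB {B : ℤ → ℕ → Polynomial ℝ} (hB : BProp B) {ℓ : ℕ} (i : Fin ℓ)
    {p : ℤ} {q t n m : ℕ} {M : SS ℓ} (hp : -1 ≤ p) (hM : BoundedBy i.castSucc t m M)
    (hdvd : p = -1 → q = 0 → X i.castSucc ∣ M) (hn : (t : ℤ) + (p + 2 * (q : ℤ)) = n) :
    ∃ Q : SS ℓ, algebraMap (SS ℓ) (KK ℓ) Q = algebraMap (SS ℓ) (KK ℓ) M * arB B ℓ p q (xx ℓ i) ∧
      BoundedBy i.castSucc n m Q := by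
  by_cases hpq : p = -1 ∧ q = 0
  · obtain ⟨M', rfl⟩ := hdvd hpq.1 hpq.2
    have hx : xx ℓ i ≠ 0 := by simp [xx]
    refine ⟨-M', ?_, (BoundedBy.of_mul_X ?_).neg⟩
    · rw [arB, if_pos hpq, map_mul, map_neg]
      change _ = xx ℓ i * _ * _
      field_simp
    · rw [mul_comm]
      exact hM.mono (by omega) le_rfl
  · obtain ⟨Q, hQ, hQb⟩ := exists_boundedBy_arB hB i hp hpq
    exact ⟨M * Q, by rw [map_mul, hQ], (hM.mul hQb).mono (by omega) le_rfl⟩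

theorem exists_boundedBy_sum {ℓ : ℕ} {s : Fin (ℓ + 1)} {n m : ℕ} {ι : Type*} {t : Finset ι}
    {f : ι → KK ℓ}
    (h : ∀ k ∈ t, ∃ Q : SS ℓ, algebraMap (SS ℓ) (KK ℓ) Q = f k ∧ BoundedBy s n m Q) :
    ∃ Q : SS ℓ, algebraMap (SS ℓ) (KK ℓ) Q = ∑ k ∈ t, f k ∧ BoundedBy s n m Q := by
  choose! Q hQ hb using h
  exact ⟨∑ k ∈ t, Q k, by rw [map_sum]; exact Finset.sum_congr rfl hQ, BoundedBy.sum hb⟩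

theorem mem_union_of_card_sub_eq_zero {ℓ : ℕ} {i j : Fin ℓ} (hij : i < j)
    {K1 K2 : Finset (Fin ℓ)} (hK1 : K1 ⊆ Jset ℓ j) (hK2 : K2 ⊆ Jset ℓ j \ K1)
    (hq : (j : ℕ) - K1.card - K2.card = 0) : i ∈ K1 ∪ K2 := by
  have hdisj : Disjoint K1 K2 := (disjoint_sdiff (s := K1) (t := Jset ℓ j)).mono_right hK2
  have heq : K1 ∪ K2 = Jset ℓ j :=
    Finset.eq_of_subset_of_card_le (union_subset hK1 (hK2.trans sdiff_subset))
      (by rw [card_union_of_disjoint hdisj, card_Jset]; omega)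
  simpa [heq, Jset] using hij

theorem phi_eq_linear_mul {B : ℤ → ℕ → Polynomial ℝ} (hB : BProp B) {ℓ : ℕ} {i j : Fin ℓ}
    (hij : i < j) :
    ∃ L Q : SS ℓ, phi B ℓ j i = algebraMap (SS ℓ) (KK ℓ) (L * Q) ∧
      (∀ e ∈ L.support, ∃ b, i.castSucc < b ∧ e = Finsupp.single b 1) ∧
      BoundedBy i.castSucc (2 * ℓ - 3) 2 Q := by
  have hij' : (i : ℕ) < j := hij
  have hjl := j.isLt
  have hsub : ∀ K1 ∈ (Jset ℓ j).powerset, ∀ K2 ∈ (Jset ℓ j \ K1).powerset,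
      Disjoint K1 K2 ∧ K1.card + K2.card ≤ j ∧
        ((j : ℕ) - K1.card - K2.card = 0 → X i.castSucc ∣ pairMonomial ℓ K1 K2) := by
    intro K1 hK1 K2 hK2
    rw [mem_powerset] at hK1 hK2
    have hdisj : Disjoint K1 K2 := (disjoint_sdiff (s := K1) (t := Jset ℓ j)).mono_right hK2
    refine ⟨hdisj, ?_, fun hq =>
      X_dvd_pairMonomial (mem_union_of_card_sub_eq_zero hij hK1 hK2 hq)⟩
    rw [← card_union_of_disjoint hdisj, ← card_Jset]
    exact card_le_card (union_subset hK1 (hK2.trans sdiff_subset))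
  unfold phi
  split_ifs with h
  · set j' : Fin ℓ := ⟨(j : ℕ) + 1, h⟩ with hj'
    have hsum := exists_boundedBy_sum (s := i.castSucc) (n := 2 * ℓ - 3) (m := 2)
      (t := (Jset ℓ j).powerset)
      (f := fun K1 => ∑ K2 ∈ ((Jset ℓ j) \ K1).powerset,
        (∏ a ∈ K1, xx ℓ a) * (∏ a ∈ K2, xx ℓ a) ^ 2 * (-zz ℓ) ^ K1.card *
          ∑ n1 ∈ Finset.range 3, ∑ n2 ∈ Finset.range (ℓ - (j : ℕ) - 1),
            (-1 : KK ℓ) ^ (n1 + n2) *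
              esymVal ({j, j'} : Finset (Fin ℓ)) (xx ℓ) n1 *
              esymVal (univ.filter (fun a : Fin ℓ => (j : ℕ) + 1 < (a : ℕ)))
                (fun a => xx ℓ a ^ 2) n2 *
              arB B ℓ ((2 - (n1 : ℤ)) + 2 * ((ℓ : ℤ) - (j : ℤ) - 2 - (n2 : ℤ)) - 1)
                ((j : ℕ) - K1.card - K2.card) (xx ℓ i)) (by
        intro K1 hK1
        refine exists_boundedBy_sum fun K2 hK2 => ?_
        obtain ⟨hdisj, hcard, hdvd⟩ := hsub K1 hK1 K2 hK2
        simp only [mul_sum]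
        refine exists_boundedBy_sum fun n1 hn1 => exists_boundedBy_sum fun n2 hn2 => ?_
        rw [mem_range] at hn1 hn2
        have hj_mem : ∀ a ∈ ({j, j'} : Finset (Fin ℓ)),
            BoundedBy i.castSucc 1 0 (X a.castSucc : SS ℓ) := by
          intro a ha
          refine BoundedBy.X_of_le (Fin.castSucc_le_castSucc_iff.2 ?_)
          rw [Fin.le_def]
          rcases Finset.mem_insert.1 ha with rfl | ha
          · omega
          · rw [Finset.mem_singleton.1 ha, hj']
            simp
            omega
        have htail : ∀ a ∈ univ.filter (fun a : Fin ℓ => (j : ℕ) + 1 < (a : ℕ)),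
            BoundedBy i.castSucc 2 0 ((X a.castSucc : SS ℓ) ^ 2) := by
          intro a ha
          rw [mem_filter] at ha
          refine (BoundedBy.X_of_le (Fin.castSucc_le_castSucc_iff.2 ?_)).pow 2
          rw [Fin.le_def]
          omega
        have hM := (boundedBy_pairMonomial i hdisj).mul
          ((((BoundedBy.const ((-1 : ℝ) ^ (n1 + n2))).mul
            (BoundedBy.esymVal (k := n1) hj_mem))).mul (BoundedBy.esymVal (k := n2) htail))
        obtain ⟨Q, hQ, hQb⟩ := exists_boundedBy_mul_arB hB i (n := 2 * ℓ - 3)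
          (p := (2 - (n1 : ℤ)) + 2 * ((ℓ : ℤ) - (j : ℤ) - 2 - (n2 : ℤ)) - 1)
          (q := (j : ℕ) - K1.card - K2.card) (by omega) hM
          (fun _ hq => (hdvd hq).mul_right _) (by push_cast; omega)
        refine ⟨Q, ?_, hQb⟩
        rw [hQ, map_mul, map_mul, map_mul, algebraMap_pairMonomial, map_esymVal, map_esymVal]
        simp only [map_pow, map_neg, map_one, mul_assoc]
        rfl)
    obtain ⟨Q, hQ, hQb⟩ := hsum
    refine ⟨X j.castSucc - X j'.castSucc - X (Fin.last ℓ), Q, ?_, ?_, hQb⟩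
    · rw [map_mul, hQ]
      simp only [map_sub]
      rfl
    · intro e he
      have hlt : i.castSucc < j'.castSucc := by
        simp only [Fin.lt_def, Fin.val_castSucc, hj']
        omega
      rcases Finset.mem_union.1 (support_sub _ _ _ he) with he | he
      · rcases Finset.mem_union.1 (support_sub _ _ _ he) with he | he
        · exact ⟨j.castSucc, Fin.castSucc_lt_castSucc_iff.2 hij, by simpa [support_X] using he⟩
        · exact ⟨j'.castSucc, hlt, by simpa [support_X] using he⟩
      · exact ⟨Fin.last ℓ, Fin.castSucc_lt_last i, by simpa [support_X] using he⟩
  · have hsum := exists_boundedBy_sum (s := i.castSucc) (n := 2 * ℓ - 3) (m := 2)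
      (t := (Jset ℓ j).powerset)
      (f := fun K1 => ∑ K2 ∈ ((Jset ℓ j) \ K1).powerset,
        (∏ a ∈ K1, xx ℓ a) * (∏ a ∈ K2, xx ℓ a) ^ 2 * (-zz ℓ) ^ K1.card *
          arB B ℓ (-1) ((j : ℕ) - K1.card - K2.card) (xx ℓ i)) (by
        intro K1 hK1
        refine exists_boundedBy_sum fun K2 hK2 => ?_
        obtain ⟨hdisj, hcard, hdvd⟩ := hsub K1 hK1 K2 hK2
        rw [← algebraMap_pairMonomial]
        exact exists_boundedBy_mul_arB hB i le_rfl (boundedBy_pairMonomial i hdisj)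
          (fun _ => hdvd) (by push_cast; omega))
    obtain ⟨Q, hQ, hQb⟩ := hsum
    refine ⟨-X j.castSucc, Q, ?_, ?_, hQb⟩
    · rw [map_mul, hQ, map_neg, mul_sum]
      refine Finset.sum_congr rfl fun K1 _ => ?_
      rw [mul_sum]
      refine Finset.sum_congr rfl fun K2 _ => ?_
      change _ = -xx ℓ j * _
      ring
    · intro e he
      exact ⟨j.castSucc, Fin.castSucc_lt_castSucc_iff.2 hij, by simpa [support_X] using he⟩

theorem toLex_lt_expo {ℓ : ℕ} {i : Fin ℓ} {d : Fin (ℓ + 1) →₀ ℕ}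
    (hle : ∀ a < i.castSucc, d a ≤ 2)
    (hlt : (∀ a < i.castSucc, d a = 2) → d i.castSucc < 2 * (ℓ - 1 - (i : ℕ))) :
    toLex d < toLex (expo ℓ i) := by
  have hexpo : ∀ a < i.castSucc, expo ℓ i a = 2 := by
    intro a ha
    have ha' : (a : ℕ) < i := ha
    simp [expo, ha']
  by_contra hnot
  have heq : ∀ k, ∀ a : Fin (ℓ + 1), (a : ℕ) = k → a < i.castSucc → d a = 2 := by
    intro k
    induction k using Nat.strong_induction_on with
    | _ k ih =>
      rintro a rfl ha
      by_contra hne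
      refine hnot (Finsupp.Lex.lt_iff.2 ⟨a, fun b hb => ?_, ?_⟩)
      · exact (ih b hb b rfl (hb.trans ha)).trans (hexpo b (hb.trans ha)).symm
      · exact (lt_of_le_of_ne (hle a ha) hne).trans_eq (hexpo a ha).symm
  refine hnot (Finsupp.Lex.lt_iff.2 ⟨i.castSucc, fun b hb => ?_, ?_⟩)
  · exact (heq b b rfl hb).trans (hexpo b hb).symm
  · exact (hlt fun a => heq a a rfl).trans_eq (by simp [expo])

/-- Let `ℓ ≥ 2` and let `1 ≤ i < j ≤ ℓ`.  If `φ_j(x_i)` is nonzero, then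
`in(φ_j(x_i)) < x_1²·x_2²⋯x_{i−1}²·x_i^{2ℓ−2i}` in the pure lexicographic order
(strict inequality): every monomial of `φ_j(x_i)` is lexicographically strictly
smaller than this one. -/
theorem initial_phi_lt (B : ℤ → ℕ → Polynomial ℝ) (hB : BProp B)
    (ℓ : ℕ) (hℓ : 2 ≤ ℓ) (i j : Fin ℓ) (hij : i < j) (h0 : phi B ℓ j i ≠ 0) :
    ∀ P : SS ℓ, algebraMap (SS ℓ) (KK ℓ) P = phi B ℓ j i →
      ∀ d ∈ P.support, toLex d < toLex (expo ℓ i) := by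
  intro P hP d hd
  obtain ⟨L, Q, hφ, hL, hdeg, hQ⟩ := phi_eq_linear_mul hB hij
  obtain rfl : P = L * Q := IsFractionRing.injective (SS ℓ) (KK ℓ) (hP.trans hφ)
  obtain ⟨e, he, f, hf, rfl⟩ := Finset.mem_add.1 (support_mul L Q hd)
  obtain ⟨b, hb, rfl⟩ := hL e he
  have hval : ∀ a ≤ i.castSucc, (Finsupp.single b 1 + f : Fin (ℓ + 1) →₀ ℕ) a = f a :=
    fun a ha => by simp [Finsupp.single_eq_of_ne (ha.trans_lt hb).ne]
  refine toLex_lt_expo (fun a ha => ?_) fun htwo => ?_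
  · rw [hval a ha.le]
    exact (monomial_le_degreeOf a hf).trans (hQ a ha)
  · rw [hval _ le_rfl]
    have hsum : ∑ a ∈ Finset.Iic i.castSucc, f a ≤ 2 * ℓ - 3 := by
      refine le_trans ?_ ((le_totalDegree hf).trans hdeg)
      rw [Finsupp.sum_fintype _ _ fun _ => rfl]
      exact Finset.sum_le_sum_of_subset (Finset.subset_univ _)
    rw [← Finset.Iio_insert, Finset.sum_insert (by simp),
      Finset.sum_congr rfl fun a ha =>
        (hval a (mem_Iio.1 ha).le).symm.trans (htwo a (mem_Iio.1 ha))] at hsum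
    simp at hsum
    have := j.isLt
    have : (i : ℕ) < j := hij
    omega

end
end
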